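/- arXiv:1906.02463 — 7 statements merged into one kernel-verified Lean document; each statement's English description precedes it below -/
import Mathlib

section
/- Let A be a real symmetric 2N×2N matrix, k a positive integer and λ > 0. The matrix T_{k,λ}(A) is singular (i.e., has a nontrivial kernel) if and only if i·(k/λ) is an eigenvalue of the matrix J·A over ℂ. -/
open Matrix

/-- The standard symplectic `2N × 2N` matrix `J = [[0, I],[−I, 0]]`. -/
noncomputable def symJ (N : ℕ) : Matrix (Fin N ⊕ Fin N) (Fin N ⊕ Fin N) ℝ :=
  Matrix.fromBlocks 0 1 (-1) 0

/-- The `4N × 4N` block matrix `T_{k,λ}(A) = [[−(λ/k)A, −J],[J, −(λ/k)A]]`. -/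
noncomputable def Tmat (N : ℕ) (k : ℕ) (lam : ℝ)
    (A : Matrix (Fin N ⊕ Fin N) (Fin N ⊕ Fin N) ℝ) :
    Matrix ((Fin N ⊕ Fin N) ⊕ (Fin N ⊕ Fin N)) ((Fin N ⊕ Fin N) ⊕ (Fin N ⊕ Fin N)) ℝ :=
  Matrix.fromBlocks ((-(lam / (k : ℝ))) • A) (-(symJ N)) (symJ N) ((-(lam / (k : ℝ))) • A)

theorem symJ_mul_self (N : ℕ) : symJ N * symJ N = -1 := by
  rw [symJ, Matrix.fromBlocks_multiply, ← Matrix.fromBlocks_one, Matrix.fromBlocks_neg]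
  simp

theorem symJ_mulVec_symJ_mulVec (N : ℕ) (x : Fin N ⊕ Fin N → ℝ) :
    symJ N *ᵥ (symJ N *ᵥ x) = -x := by
  rw [Matrix.mulVec_mulVec, symJ_mul_self, Matrix.neg_mulVec, Matrix.one_mulVec]

theorem symJ_mulVec_injective (N : ℕ) : Function.Injective (symJ N).mulVec := by
  intro x y h
  have hJ := congrArg (symJ N).mulVec h
  simpa only [symJ_mulVec_symJ_mulVec, neg_inj] using hJ

/-- The kernel of `T_{k,λ}(A)` in terms of the two halves of a vector. -/
theorem Tmat_mulVec_eq_zero_iff (N : ℕ) (k : ℕ) (hk : 0 < k) (lam : ℝ) (hlam : 0 < lam)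
    (A : Matrix (Fin N ⊕ Fin N) (Fin N ⊕ Fin N) ℝ) (x y : Fin N ⊕ Fin N → ℝ) :
    Tmat N k lam A *ᵥ Sum.elim x y = 0 ↔
      (symJ N * A) *ᵥ x = ((k : ℝ) / lam) • y ∧ (symJ N * A) *ᵥ y = -(((k : ℝ) / lam) • x) := by
  have hk' : (k : ℝ) ≠ 0 := by positivity
  have hl' : lam ≠ 0 := hlam.ne'
  have key : ∀ u w : Fin N ⊕ Fin N → ℝ,
      (lam / (k : ℝ)) • (A *ᵥ u) + symJ N *ᵥ w = 0 ↔
        (symJ N * A) *ᵥ u = ((k : ℝ) / lam) • w := by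
    intro u w
    rw [← (symJ_mulVec_injective N).eq_iff, Matrix.mulVec_add, Matrix.mulVec_smul,
      symJ_mulVec_symJ_mulVec, Matrix.mulVec_zero, Matrix.mulVec_mulVec, ← sub_eq_add_neg,
      sub_eq_zero, ← inv_div lam (k : ℝ), eq_inv_smul_iff₀ (div_ne_zero hl' hk')]
  rw [Tmat, Matrix.fromBlocks_mulVec, ← smul_neg, ← key x y, ← key y (-x)]
  simp only [Sum.elim_comp_inl, Sum.elim_comp_inr, Matrix.neg_mulVec, Matrix.smul_mulVec,
    Matrix.mulVec_neg, neg_smul]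
  rw [← Sum.elim_zero_zero, Sum.elim_eq_iff, ← neg_add, neg_eq_zero, ← neg_eq_zero (a := _ + -_),
    neg_add, neg_neg, neg_add_eq_sub, sub_eq_add_neg]

/-- Eigenvectors of a real matrix for `i·c`, split into real and imaginary parts. -/
theorem map_ofReal_mulVec_eq_I_mul_smul_iff {n : Type*} [Fintype n] (B : Matrix n n ℝ) (c : ℝ)
    (z : n → ℂ) :
    B.map (fun x : ℝ => (x : ℂ)) *ᵥ z = (Complex.I * (c : ℂ)) • z ↔
      (B *ᵥ fun i => (z i).re) = c • (fun i => -(z i).im) ∧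
        (B *ᵥ fun i => -(z i).im) = -(c • fun i => (z i).re) := by
  simp only [funext_iff, ← forall_and, Matrix.mulVec, dotProduct, Complex.ext_iff]
  refine forall_congr' fun i => ?_
  simp [Finset.sum_neg_distrib]

theorem mem_spectrum_iff_exists_mulVec_eq_smul {n K : Type*} [Fintype n] [DecidableEq n] [Field K]
    (M : Matrix n n K) (μ : K) :
    μ ∈ spectrum K M ↔ ∃ z : n → K, z ≠ 0 ∧ M *ᵥ z = μ • z := by
  rw [spectrum.mem_iff, Matrix.isUnit_iff_isUnit_det, isUnit_iff_ne_zero, not_not,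
    ← Matrix.exists_mulVec_eq_zero_iff]
  simp only [Matrix.sub_mulVec, Algebra.algebraMap_eq_smul_one, Matrix.smul_mulVec,
    Matrix.one_mulVec, sub_eq_zero, eq_comm]

/-- `T_{k,λ}(A)` is singular (has a nontrivial kernel) iff `i·(k/λ)` is an eigenvalue of
`J·A` over `ℂ`. -/
theorem stmt0 (N : ℕ) (k : ℕ) (hk : 0 < k) (lam : ℝ) (hlam : 0 < lam)
    (A : Matrix (Fin N ⊕ Fin N) (Fin N ⊕ Fin N) ℝ) (hA : A.IsSymm) :
    (∃ v : ((Fin N ⊕ Fin N) ⊕ (Fin N ⊕ Fin N)) → ℝ, v ≠ 0 ∧ (Tmat N k lam A).mulVec v = 0) ↔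
      (Complex.I * ((k : ℂ) / (lam : ℂ))) ∈
        spectrum ℂ ((symJ N * A).map (fun x : ℝ => (x : ℂ))) := by
  have hc : (k : ℂ) / (lam : ℂ) = (((k : ℝ) / lam : ℝ) : ℂ) := by push_cast; rfl
  rw [hc, mem_spectrum_iff_exists_mulVec_eq_smul]
  constructor
  · rintro ⟨v, hv, h⟩
    rw [← Sum.elim_comp_inl_inr v, Tmat_mulVec_eq_zero_iff N k hk lam hlam] at h
    refine ⟨fun i => ⟨v (Sum.inl i), -v (Sum.inr i)⟩, fun h0 => hv ?_, ?_⟩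
    · ext (i | i)
      · simpa using congrArg Complex.re (congrFun h0 i)
      · simpa using congrArg Complex.im (congrFun h0 i)
    · rw [map_ofReal_mulVec_eq_I_mul_smul_iff]
      simp only [neg_neg]
      exact h
  · rintro ⟨z, hz, h⟩
    rw [map_ofReal_mulVec_eq_I_mul_smul_iff] at h
    refine ⟨Sum.elim (fun i => (z i).re) (fun i => -(z i).im), fun h0 => hz ?_, ?_⟩
    · ext i
      apply Complex.ext
      · simpa using congrFun h0 (Sum.inl i)
      · simpa using congrFun h0 (Sum.inr i)
    · rwa [Tmat_mulVec_eq_zero_iff N k hk lam hlam]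
end

section
/- Let A be a real symmetric nonsingular 2N×2N matrix. There exists Λ₀ > 0 such that for all λ > Λ₀, the Morse index of T_{1,λ}(A) equals 2·m⁺(A), where m⁺(A) is the number of positive eigenvalues of A counted with multiplicity. -/
open Matrix

/-- The Morse index `m⁻(S)`: the number of negative eigenvalues of a real symmetric matrix `S`,
counted with multiplicity. -/
noncomputable def morseIndex {n : Type*} [Fintype n] [DecidableEq n]
    {S : Matrix n n ℝ} (hS : S.IsHermitian) : ℕ :=
  Nat.card {i // hS.eigenvalues i < 0}

/-- The number `m⁺(S)` of positive eigenvalues of a real symmetric matrix `S`,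
counted with multiplicity. -/
noncomputable def posIndex {n : Type*} [Fintype n] [DecidableEq n]
    {S : Matrix n n ℝ} (hS : S.IsHermitian) : ℕ :=
  Nat.card {i // 0 < hS.eigenvalues i}

/-- A real symmetric form in the coordinates given by the eigenvector matrix. -/
theorem dotProduct_mulVec_eq_sum_eigenvalues {n : Type*} [Fintype n] [DecidableEq n]
    {S : Matrix n n ℝ} (hS : S.IsHermitian) (x : n → ℝ) :
    x ⬝ᵥ S *ᵥ x = ∑ i, hS.eigenvalues i *
      ((star (hS.eigenvectorUnitary : Matrix n n ℝ)) *ᵥ x) i ^ 2 := by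
  conv_lhs => rw [hS.spectral_theorem]
  rw [Unitary.conjStarAlgAut_apply, ← mulVec_mulVec, ← mulVec_mulVec, dotProduct_mulVec,
    ← mulVec_transpose]
  simp only [dotProduct, mulVec_diagonal, star_eq_conjTranspose,
    conjTranspose_eq_transpose_of_trivial]
  refine Finset.sum_congr rfl fun i _ => ?_
  simp
  ring

/-- A space on which a symmetric form is definite has dimension at most the number of
eigenvalues of the corresponding sign. -/
theorem finrank_le_card_eigenvalues {n W : Type*} [Fintype n] [DecidableEq n]
    [AddCommGroup W] [Module ℝ W] {S : Matrix n n ℝ} (hS : S.IsHermitian) (ε : ℝ)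
    (f : W →ₗ[ℝ] (n → ℝ)) (hf : ∀ w, w ≠ 0 → 0 < ε * (f w ⬝ᵥ S *ᵥ f w)) :
    Module.finrank ℝ W ≤ Nat.card {i // 0 < ε * hS.eigenvalues i} := by
  classical
  let g : W →ₗ[ℝ] ({i // 0 < ε * hS.eigenvalues i} → ℝ) :=
    LinearMap.funLeft ℝ ℝ Subtype.val ∘ₗ
      (star (hS.eigenvectorUnitary : Matrix n n ℝ)).mulVecLin ∘ₗ f
  have hg : Function.Injective g := by
    rw [← LinearMap.ker_eq_bot, LinearMap.ker_eq_bot']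
    intro w hw
    by_contra hne
    refine (hf w hne).not_ge ?_
    rw [dotProduct_mulVec_eq_sum_eigenvalues hS, Finset.mul_sum]
    refine Finset.sum_nonpos fun i _ => ?_
    rw [← mul_assoc]
    by_cases hi : 0 < ε * hS.eigenvalues i
    · have h : (star (hS.eigenvectorUnitary : Matrix n n ℝ) *ᵥ f w) i = 0 :=
        congrFun hw ⟨i, hi⟩
      simp [h]
    · exact mul_nonpos_of_nonpos_of_nonneg (not_lt.mp hi) (sq_nonneg _)
  have h := LinearMap.finrank_le_finrank_of_injective hg
  rwa [Module.finrank_fintype_fun_eq_card, ← Nat.card_eq_fintype_card] at h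

theorem symJ_mulVec_dotProduct_self {N : ℕ} (y : Fin N ⊕ Fin N → ℝ) :
    (symJ N *ᵥ y) ⬝ᵥ (symJ N *ᵥ y) = y ⬝ᵥ y := by
  simp [symJ, fromBlocks_mulVec, dotProduct, neg_mulVec, add_comm]

theorem abs_dotProduct_symJ_mulVec_le {N : ℕ} (x y : Fin N ⊕ Fin N → ℝ) :
    |x ⬝ᵥ symJ N *ᵥ y| ≤ (x ⬝ᵥ x + y ⬝ᵥ y) / 2 := by
  have hJ := symJ_mulVec_dotProduct_self y
  set z := symJ N *ᵥ y
  have h1 : 0 ≤ (x + z) ⬝ᵥ (x + z) := Finset.sum_nonneg fun i _ => mul_self_nonneg _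
  have h2 : 0 ≤ (x - z) ⬝ᵥ (x - z) := Finset.sum_nonneg fun i _ => mul_self_nonneg _
  simp only [add_dotProduct, dotProduct_add, sub_dotProduct, dotProduct_sub,
    dotProduct_comm z x] at h1 h2
  rw [abs_le]
  constructor <;> linarith

theorem Tmat_one_form {N : ℕ} (lam : ℝ) (A : Matrix (Fin N ⊕ Fin N) (Fin N ⊕ Fin N) ℝ)
    (x y : Fin N ⊕ Fin N → ℝ) :
    Sum.elim x y ⬝ᵥ Tmat N 1 lam A *ᵥ Sum.elim x y =
      -lam * (x ⬝ᵥ A *ᵥ x + y ⬝ᵥ A *ᵥ y) - x ⬝ᵥ symJ N *ᵥ y + y ⬝ᵥ symJ N *ᵥ x := by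
  simp only [Tmat, fromBlocks_mulVec, sumElim_dotProduct_sumElim, Sum.elim_comp_inl,
    Sum.elim_comp_inr, smul_mulVec, neg_mulVec, dotProduct_add, dotProduct_neg, dotProduct_smul,
    smul_eq_mul, Nat.cast_one, div_one]
  ring

/-- The linear combinations of the eigenvectors of `A` whose eigenvalue has the sign of `ε`. -/
noncomputable def eigenspan {n : Type*} [Fintype n] [DecidableEq n]
    {A : Matrix n n ℝ} (hA : A.IsHermitian) (ε : ℝ) :
    ({i // 0 < ε * hA.eigenvalues i} → ℝ) →ₗ[ℝ] (n → ℝ) :=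
  (hA.eigenvectorUnitary : Matrix n n ℝ).mulVecLin ∘ₗ
    Function.ExtendByZero.linearMap ℝ Subtype.val

theorem star_eigenvectorUnitary_mulVec_eigenspan {n : Type*} [Fintype n] [DecidableEq n]
    {A : Matrix n n ℝ} (hA : A.IsHermitian) (ε : ℝ)
    (u : {i // 0 < ε * hA.eigenvalues i} → ℝ) :
    star (hA.eigenvectorUnitary : Matrix n n ℝ) *ᵥ eigenspan hA ε u =
      Function.extend Subtype.val u 0 := by
  simp only [eigenspan, LinearMap.comp_apply, mulVecLin_apply, mulVec_mulVec,
    Unitary.coe_star_mul_self, one_mulVec]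
  rfl

theorem dotProduct_self_le_eigenspan {n : Type*} [Fintype n] [DecidableEq n]
    {A : Matrix n n ℝ} (hA : A.IsHermitian) {ε lam : ℝ}
    (hlam : ∀ i, 0 < ε * hA.eigenvalues i → 1 < lam * (ε * hA.eigenvalues i))
    {u : {i // 0 < ε * hA.eigenvalues i} → ℝ} :
    eigenspan hA ε u ⬝ᵥ eigenspan hA ε u ≤
        lam * (ε * (eigenspan hA ε u ⬝ᵥ A *ᵥ eigenspan hA ε u)) ∧
      (u ≠ 0 → eigenspan hA ε u ⬝ᵥ eigenspan hA ε u <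
        lam * (ε * (eigenspan hA ε u ⬝ᵥ A *ᵥ eigenspan hA ε u))) := by
  have hself : eigenspan hA ε u ⬝ᵥ eigenspan hA ε u =
      ∑ i, Function.extend Subtype.val u 0 i ^ 2 := by
    rw [← star_eigenvectorUnitary_mulVec_eigenspan]
    set x := eigenspan hA ε u
    have h : x = (hA.eigenvectorUnitary : Matrix n n ℝ) *ᵥ
        (star (hA.eigenvectorUnitary : Matrix n n ℝ) *ᵥ x) := by simp [mulVec_mulVec]
    have h' : x ⬝ᵥ x = (star (hA.eigenvectorUnitary : Matrix n n ℝ) *ᵥ x) ⬝ᵥ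
        (star (hA.eigenvectorUnitary : Matrix n n ℝ) *ᵥ x) := by
      conv_lhs => rw [h]
      rw [← h, dotProduct_comm, h, dotProduct_mulVec, ← mulVec_transpose, ← h]
      rfl
    rw [h']
    exact Finset.sum_congr rfl fun i _ => (sq _).symm
  rw [hself, dotProduct_mulVec_eq_sum_eigenvalues hA, star_eigenvectorUnitary_mulVec_eigenspan,
    Finset.mul_sum, Finset.mul_sum]
  have hle : ∀ i, Function.extend Subtype.val u 0 i ^ 2 ≤
      lam * (ε * (hA.eigenvalues i * Function.extend Subtype.val u 0 i ^ 2)) := by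
    intro i
    by_cases hi : 0 < ε * hA.eigenvalues i
    · nlinarith [hlam i hi, sq_nonneg (Function.extend Subtype.val u 0 i)]
    · have h0 : Function.extend Subtype.val u 0 i = 0 :=
        Function.extend_apply' u (0 : n → ℝ) i fun ⟨j, hj⟩ => hi (hj ▸ j.2)
      simp [h0]
  refine ⟨Finset.sum_le_sum fun i _ => hle i, fun hu => ?_⟩
  obtain ⟨j, hj⟩ := Function.ne_iff.mp hu
  refine Finset.sum_lt_sum (fun i _ => hle i) ⟨j, Finset.mem_univ _, ?_⟩
  rw [Subtype.val_injective.extend_apply]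
  have hpos : 0 < u j ^ 2 := sq_pos_of_ne_zero hj
  nlinarith [hlam j j.2]

theorem two_mul_card_le_card_eigenvalues_Tmat {N : ℕ}
    {A : Matrix (Fin N ⊕ Fin N) (Fin N ⊕ Fin N) ℝ} (hA : A.IsHermitian) {ε lam : ℝ}
    (hε : |ε| = 1) (hlam : ∀ i, 0 < ε * hA.eigenvalues i → 1 < lam * (ε * hA.eigenvalues i))
    (hT : (Tmat N 1 lam A).IsHermitian) :
    2 * Nat.card {i // 0 < ε * hA.eigenvalues i} ≤
      Nat.card {i // 0 < -ε * hT.eigenvalues i} := by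
  classical
  let f : ({i // 0 < ε * hA.eigenvalues i} → ℝ) × ({i // 0 < ε * hA.eigenvalues i} → ℝ) →ₗ[ℝ]
      ((Fin N ⊕ Fin N) ⊕ (Fin N ⊕ Fin N) → ℝ) :=
    (LinearEquiv.sumArrowLequivProdArrow _ _ ℝ ℝ).symm.toLinearMap ∘ₗ
      (eigenspan hA ε).prodMap (eigenspan hA ε)
  have hf : ∀ w, f w = Sum.elim (eigenspan hA ε w.1) (eigenspan hA ε w.2) := fun _ => rfl
  have h := finrank_le_card_eigenvalues hT (-ε) f fun w hw => ?_
  · simpa [Module.finrank_prod, two_mul, Nat.card_eq_fintype_card] using h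
  rw [hf, Tmat_one_form]
  obtain ⟨h1, h1'⟩ := dotProduct_self_le_eigenspan hA hlam (u := w.1)
  obtain ⟨h2, h2'⟩ := dotProduct_self_le_eigenspan hA hlam (u := w.2)
  have hxy := abs_dotProduct_symJ_mulVec_le (eigenspan hA ε w.1) (eigenspan hA ε w.2)
  have hyx := abs_dotProduct_symJ_mulVec_le (eigenspan hA ε w.2) (eigenspan hA ε w.1)
  have hcases : w.1 ≠ 0 ∨ w.2 ≠ 0 := by
    by_contra! h0
    exact hw (Prod.ext h0.1 h0.2)
  have hstrict : eigenspan hA ε w.1 ⬝ᵥ eigenspan hA ε w.1 +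
      eigenspan hA ε w.2 ⬝ᵥ eigenspan hA ε w.2 <
      lam * (ε * (eigenspan hA ε w.1 ⬝ᵥ A *ᵥ eigenspan hA ε w.1)) +
      lam * (ε * (eigenspan hA ε w.2 ⬝ᵥ A *ᵥ eigenspan hA ε w.2)) := by
    rcases hcases with h0 | h0
    · exact add_lt_add_of_lt_of_le (h1' h0) h2
    · exact add_lt_add_of_le_of_lt h1 (h2' h0)
  rw [abs_le] at hxy hyx
  rcases eq_or_eq_neg_of_abs_eq hε with rfl | rfl <;> linarith

/-- For a real symmetric nonsingular `2N × 2N` matrix `A`, there is `Λ₀ > 0` such that for all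
`λ > Λ₀` the Morse index of `T_{1,λ}(A)` equals `2·m⁺(A)`. -/
theorem stmt8 (N : ℕ) (A : Matrix (Fin N ⊕ Fin N) (Fin N ⊕ Fin N) ℝ)
    (hA : A.IsHermitian) (hdet : A.det ≠ 0) :
    ∃ Λ₀ : ℝ, 0 < Λ₀ ∧ ∀ lam : ℝ, Λ₀ < lam →
      ∀ hT : (Tmat N 1 lam A).IsHermitian, morseIndex hT = 2 * posIndex hA := by
  have hne : ∀ i, hA.eigenvalues i ≠ 0 := fun i h0 => hdet <| by
    rw [hA.det_eq_prod_eigenvalues]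
    exact Finset.prod_eq_zero (Finset.mem_univ i) (by simp [h0])
  have hsum : 0 ≤ ∑ i, |hA.eigenvalues i|⁻¹ := Finset.sum_nonneg fun i _ => by positivity
  refine ⟨1 + ∑ i, |hA.eigenvalues i|⁻¹, by positivity, fun lam hlam hT => ?_⟩
  have hbound : ∀ i, 1 < lam * |hA.eigenvalues i| := fun i => by
    have hi : |hA.eigenvalues i|⁻¹ ≤ ∑ i, |hA.eigenvalues i|⁻¹ :=
      Finset.single_le_sum (f := fun i => |hA.eigenvalues i|⁻¹)
        (fun j _ => by positivity) (Finset.mem_univ i)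
    exact (inv_lt_iff_one_lt_mul₀ (abs_pos.mpr (hne i))).mp (by linarith)
  have hpos := two_mul_card_le_card_eigenvalues_Tmat hA (ε := 1) (by simp)
    (fun i hi => by simpa [abs_of_pos ((one_mul (hA.eigenvalues i)) ▸ hi)] using hbound i) hT
  have hneg := two_mul_card_le_card_eigenvalues_Tmat hA (ε := -1) (by simp)
    (fun i hi => by
      have hi' : hA.eigenvalues i < 0 := by linarith
      simpa [abs_of_neg hi'] using hbound i) hT
  simp only [one_mul, neg_mul, neg_neg, Left.neg_pos_iff] at hpos hneg
  have hcardA : Nat.card {i // 0 < hA.eigenvalues i} + Nat.card {i // hA.eigenvalues i < 0} =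
      N + N := by
    have h := Fintype.card_subtype_compl fun i => 0 < hA.eigenvalues i
    have hle := Fintype.card_subtype_le fun i => 0 < hA.eigenvalues i
    have hiff : ∀ i, hA.eigenvalues i < 0 ↔ ¬ 0 < hA.eigenvalues i := fun i =>
      ⟨fun h => h.not_gt, fun h => lt_of_le_of_ne (not_lt.mp h) (hne i)⟩
    simp only [Nat.card_eq_fintype_card, Fintype.card_congr (Equiv.subtypeEquivRight hiff)]
    simp only [Fintype.card_sum, Fintype.card_fin] at h hle
    omega
  have hcardT : Nat.card {i // 0 < hT.eigenvalues i} + Nat.card {i // hT.eigenvalues i < 0} ≤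
      N + N + (N + N) := by
    have hdisj : Disjoint (fun i => 0 < hT.eigenvalues i) fun i => hT.eigenvalues i < 0 :=
      Pi.disjoint_iff.mpr fun i => by
        rw [disjoint_iff_inf_le]
        exact fun h => lt_asymm h.1 h.2
    have h := Fintype.card_subtype_or_disjoint _ _ hdisj
    have hle := Fintype.card_subtype_le fun i => 0 < hT.eigenvalues i ∨ hT.eigenvalues i < 0
    simp only [Fintype.card_sum, Fintype.card_fin] at hle
    simp only [Nat.card_eq_fintype_card]
    omega
  unfold morseIndex posIndex
  omega
end

section
/- Let A be a real symmetric nonsingular 2N×2N matrix such that the number of positive eigenvalues of A counted with multiplicity is not equal to N. Then there exists β > 0 such that iβ is an eigenvalue of J·A over ℂ, i.e., J·A has a purely imaginary nonzero eigenvalue. -/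
open Matrix

open scoped Matrix.Norms.L2Operator

/-- The real-valued sign function. -/
noncomputable def realSgn (x : ℝ) : ℝ := (SignType.sign x : ℝ)

theorem continuousOn_realSgn : ContinuousOn realSgn {0}ᶜ := fun _ hx =>
  ((continuous_of_discreteTopology (f := fun s : SignType => (s : ℝ))).continuousAt.comp
    (continuousAt_sign_of_ne_zero hx)).continuousWithinAt

section Signature

variable {n : Type*} [Fintype n] [DecidableEq n]

theorem Matrix.IsHermitian.trace_cfc {𝕜 : Type*} [RCLike 𝕜] {A : Matrix n n 𝕜}
    (hA : A.IsHermitian) (f : ℝ → ℝ) :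
    (cfc f A).trace = ((∑ i, f (hA.eigenvalues i) : ℝ) : 𝕜) := by
  rw [hA.cfc_eq f, IsHermitian.cfc, Unitary.conjStarAlgAut_apply, trace_mul_comm, ← mul_assoc]
  simp [trace_diagonal]

theorem zero_notMem_spectrum_of_det_ne_zero {𝕜 : Type*} [RCLike 𝕜] {A : Matrix n n 𝕜}
    (h : A.det ≠ 0) : (0 : ℝ) ∉ spectrum ℝ A := by
  rw [spectrum.zero_notMem_iff, isUnit_iff_isUnit_det]
  exact h.isUnit

/-- The signature is constant along a continuous family of invertible Hermitian matrices. -/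
theorem trace_cfc_realSgn_eq {X : Type*} [TopologicalSpace X] {S : Set X} (hS : IsPreconnected S)
    {H : X → Matrix n n ℂ} (hc : ContinuousOn H S) (hH : ∀ x, (H x).IsHermitian)
    (hdet : ∀ x ∈ S, (H x).det ≠ 0) {x y : X} (hx : x ∈ S) (hy : y ∈ S) :
    (cfc realSgn (H x)).trace.re = (cfc realSgn (H y)).trace.re := by
  have hcfc : ContinuousOn (fun x => cfc realSgn (H x)) S := by
    refine ContinuousOn.cfc_of_mem_nhdsSet (𝕜 := ℝ) (s := {0}ᶜ) realSgn ?_ hc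
      (fun x _ => hH x) continuousOn_realSgn
    rw [isOpen_compl_singleton.mem_nhdsSet]
    refine Set.iUnion₂_subset fun x hx r hr h0 => ?_
    rw [Set.mem_singleton_iff] at h0
    exact zero_notMem_spectrum_of_det_ne_zero (hdet x hx) (h0 ▸ hr)
  have htr : ContinuousOn (fun x => (cfc realSgn (H x)).trace.re) S :=
    Complex.continuous_re.comp_continuousOn
      ((continuous_id.matrix_trace (n := n) (R := ℂ)).comp_continuousOn hcfc)
  refine hS.constant_of_mapsTo (T := Set.range ((↑) : ℤ → ℝ)) ?_ htr ?_ hx hy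
  · exact isDiscrete_iff_discreteTopology.mpr
      (Int.isClosedEmbedding_coe_real.isEmbedding.toHomeomorph.symm.isEmbedding.discreteTopology)
  · intro x _
    refine ⟨∑ i, (SignType.sign ((hH x).eigenvalues i) : ℤ), ?_⟩
    beta_reduce
    rw [(hH x).trace_cfc]
    simp only [realSgn, Complex.coe_algebraMap, Complex.ofReal_re]
    push_cast
    rfl

theorem cfc_realSgn_of_mul_self_eq_one {B : Matrix n n ℂ} (hB : B.IsHermitian) (h : B * B = 1) :
    cfc realSgn B = B := by
  have hB' : IsSelfAdjoint B := hB
  conv_rhs => rw [← cfc_id ℝ B]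
  refine cfc_congr fun r hr => ?_
  have hr2 : r ^ 2 ∈ spectrum ℝ (B ^ 2) := spectrum.pow_mem_pow B 2 hr
  rcases subsingleton_or_nontrivial (Matrix n n ℂ) with _ | _
  · simp [spectrum.of_subsingleton] at hr
  rw [pow_two B, h, spectrum.one_eq, Set.mem_singleton_iff, sq_eq_one_iff] at hr2
  rcases hr2 with rfl | rfl <;> simp [realSgn]

/-- Entrywise complexification of a real matrix, as a star algebra homomorphism. -/
noncomputable def complexifyHom (n : Type*) [Fintype n] [DecidableEq n] :
    Matrix n n ℝ →⋆ₐ[ℝ] Matrix n n ℂ :=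
  { Complex.ofRealAm.mapMatrix with
    map_star' := fun A => by
      ext i j
      simp [star_apply] }

@[simp]
theorem complexifyHom_apply (A : Matrix n n ℝ) :
    complexifyHom n A = A.map (fun x : ℝ => (x : ℂ)) := rfl

theorem trace_cfc_map_ofReal {A : Matrix n n ℝ} (hA : A.IsHermitian) (f : ℝ → ℝ) :
    (cfc f (A.map (fun x : ℝ => (x : ℂ)))).trace.re = (∑ i, f (hA.eigenvalues i) : ℝ) := by
  have hφ : Continuous (complexifyHom n) :=
    continuous_id.matrix_map Complex.continuous_ofReal
  have hmap : (A.map (fun x : ℝ => (x : ℂ))).IsHermitian := by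
    ext i j
    simpa using hA.apply i j
  have := StarAlgHom.map_cfc (complexifyHom n) f A
    (hA.spectrum_real_eq_range_eigenvalues ▸ (Set.finite_range _).continuousOn f) hφ hA hmap
  rw [complexifyHom_apply, complexifyHom_apply] at this
  have htr := hA.trace_cfc f
  simp only [RCLike.ofReal_real_eq_id, id_eq] at htr
  rw [← this, ← htr]
  simp [trace]

theorem two_mul_posIndex_of_sum_realSgn_eq_zero {A : Matrix n n ℝ} (hA : A.IsHermitian)
    (hdet : A.det ≠ 0) (h : ∑ i, realSgn (hA.eigenvalues i) = 0) :
    2 * posIndex hA = Fintype.card n := by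
  have hne : ∀ i, hA.eigenvalues i ≠ 0 := by
    rw [hA.det_eq_prod_eigenvalues] at hdet
    simpa [Finset.prod_ne_zero_iff] using hdet
  have hs : ∀ i, realSgn (hA.eigenvalues i) = 2 * (if 0 < hA.eigenvalues i then 1 else 0) - 1 := by
    intro i
    rcases (hne i).lt_or_gt with hi | hi
    · simp [realSgn, hi, hi.le.not_gt]
    · norm_num [realSgn, hi]
  simp only [hs, Finset.sum_sub_distrib, ← Finset.mul_sum, Finset.sum_boole, Finset.sum_const,
    Finset.card_univ, nsmul_eq_mul, mul_one, sub_eq_zero] at h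
  rw [posIndex, Nat.card_eq_fintype_card, Fintype.card_subtype]
  exact_mod_cast h

end Signature

/-- The complexification of `symJ N`. -/
noncomputable def symJC (N : ℕ) : Matrix (Fin N ⊕ Fin N) (Fin N ⊕ Fin N) ℂ :=
  (symJ N).map (fun x : ℝ => (x : ℂ))

theorem symJC_eq (N : ℕ) : symJC N = fromBlocks 0 1 (-1) 0 := by
  rw [symJC, symJ, fromBlocks_map]
  congr 1 <;> ext i j <;> simp [one_apply, apply_ite]

theorem symJC_mul_self (N : ℕ) : symJC N * symJC N = -1 := by
  rw [symJC_eq, fromBlocks_multiply, ← fromBlocks_one, fromBlocks_neg]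
  simp

theorem conjTranspose_symJC (N : ℕ) : (symJC N)ᴴ = -symJC N := by
  rw [symJC_eq, fromBlocks_conjTranspose, fromBlocks_neg]
  simp

theorem trace_symJC (N : ℕ) : (symJC N).trace = 0 := by
  simp [symJC_eq, trace]

theorem mem_spectrum_of_det_eq_zero {N : ℕ} {A : Matrix (Fin N ⊕ Fin N) (Fin N ⊕ Fin N) ℝ} {z : ℂ}
    (h : (A.map (fun x : ℝ => (x : ℂ)) + z • symJC N).det = 0) :
    z ∈ spectrum ℂ ((symJ N * A).map (fun x : ℝ => (x : ℂ))) := by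
  have hmul : (symJ N * A).map (fun x : ℝ => (x : ℂ)) =
      symJC N * A.map (fun x : ℝ => (x : ℂ)) :=
    (map_mul (complexifyHom _) (symJ N) A)
  have key : algebraMap ℂ _ z - (symJ N * A).map (fun x : ℝ => (x : ℂ)) =
      -(symJC N * (A.map (fun x : ℝ => (x : ℂ)) + z • symJC N)) := by
    rw [hmul, mul_add, mul_smul_comm, symJC_mul_self, Algebra.algebraMap_eq_smul_one]
    module
  rw [spectrum.mem_iff, key, IsUnit.neg_iff, isUnit_iff_isUnit_det, det_mul, h]
  simp

/-- If `A` is a real symmetric nonsingular `2N × 2N` matrix with `m⁺(A) ≠ N`, then `J·A` has a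
purely imaginary nonzero eigenvalue `iβ`, `β > 0`, over `ℂ`. -/
theorem stmt9 (N : ℕ) (A : Matrix (Fin N ⊕ Fin N) (Fin N ⊕ Fin N) ℝ)
    (hA : A.IsHermitian) (hdet : A.det ≠ 0) (hind : posIndex hA ≠ N) :
    ∃ β : ℝ, 0 < β ∧
      (Complex.I * (β : ℂ)) ∈ spectrum ℂ ((symJ N * A).map (fun x : ℝ => (x : ℂ))) := by
  by_contra! hno
  set B := A.map (fun x : ℝ => (x : ℂ)) with hB
  set K : Matrix (Fin N ⊕ Fin N) (Fin N ⊕ Fin N) ℂ := Complex.I • symJC N with hK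
  have hBH : B.IsHermitian := by
    ext i j
    simpa [hB] using hA.apply i j
  have hKH : K.IsHermitian := by
    simp [IsHermitian, hK, conjTranspose_smul, conjTranspose_symJC]
  have hKK : K * K = 1 := by
    simp [hK, smul_smul, symJC_mul_self]
  let H : ℝ → Matrix (Fin N ⊕ Fin N) (Fin N ⊕ Fin N) ℂ := fun t => (1 - t) • B + t • K
  have hHH : ∀ t, (H t).IsHermitian := fun t =>
    (hBH.smul (IsSelfAdjoint.all _)).add (hKH.smul (IsSelfAdjoint.all _))
  have hHc : Continuous H := by fun_prop
  have hHdet : ∀ t ∈ Set.Icc (0 : ℝ) 1, (H t).det ≠ 0 := by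
    rintro t ⟨ht0, ht1⟩ h0
    rcases ht1.eq_or_lt with rfl | ht1
    · have := congrArg det hKK
      simp only [H, sub_self, zero_smul, one_smul, zero_add] at h0
      simp [h0] at this
    rcases ht0.eq_or_lt with rfl | ht0
    · have hBdet : B.det = (A.det : ℂ) := (RingHom.map_det Complex.ofRealHom A).symm
      simp only [H, sub_zero, zero_smul, one_smul, add_zero] at h0
      exact hdet (Complex.ofReal_eq_zero.mp (hBdet.symm.trans h0))
    have ht : 1 - t ≠ 0 := by linarith
    refine hno (t / (1 - t)) (div_pos ht0 (by linarith)) (mem_spectrum_of_det_eq_zero ?_)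
    have hfac : H t = (1 - t) • (B + (Complex.I * ((t / (1 - t) : ℝ) : ℂ)) • symJC N) := by
      have h1 : (Complex.I * ((t / (1 - t) : ℝ) : ℂ)) • symJC N = (t / (1 - t)) • K := by
        rw [hK, mul_comm, mul_smul, Complex.coe_smul]
      rw [h1, smul_add, smul_smul, mul_div_cancel₀ _ ht]
    rw [hfac, ← Complex.coe_smul, det_smul] at h0
    exact (mul_eq_zero.mp h0).resolve_left (pow_ne_zero _ (by exact_mod_cast ht))
  have h01 := trace_cfc_realSgn_eq isPreconnected_Icc hHc.continuousOn hHH hHdet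
    (Set.left_mem_Icc.mpr zero_le_one) (Set.right_mem_Icc.mpr zero_le_one)
  have hH0 : H 0 = B := by simp [H]
  have hH1 : H 1 = K := by simp [H]
  rw [hH0, hH1, cfc_realSgn_of_mul_self_eq_one hKH hKK, hB, trace_cfc_map_ofReal hA, hK,
    trace_smul, trace_symJC, smul_zero, Complex.zero_re] at h01
  have := two_mul_posIndex_of_sum_realSgn_eq_zero hA hdet h01
  rw [Fintype.card_sum, Fintype.card_fin] at this
  omega
end

section
/- Let λ > 0 and η > 0, and let A(λ,η) be the 4×4 matrix [[−λη, 0, 0, 1],[0, −λ, −1, 0],[0, −1, −λη, 0],[1, 0, 0, −λ]]. If λ²η > 1, then all four eigenvalues of A(λ,η) (counted with multiplicity) are negative, i.e., m⁻(A(λ,η)) = 4. If 0 < λ²η < 1, then A(λ,η) has exactly two negative and two positive eigenvalues counted with multiplicity, i.e., m⁻(A(λ,η)) = 2. -/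
open Matrix

/-- The `4 × 4` real symmetric matrix `A(λ,η)`. -/
def Amat (lam η : ℝ) : Matrix (Fin 4) (Fin 4) ℝ :=
  !![-(lam * η), 0, 0, 1;
     0, -lam, -1, 0;
     0, -1, -(lam * η), 0;
     1, 0, 0, -lam]

open Polynomial in
theorem Amat_charpoly {lam η r s : ℝ} (hsum : r + s = -(lam * (1 + η)))
    (hprod : r * s = lam ^ 2 * η - 1) :
    (Amat lam η).charpoly = (({r, r, s, s} : Multiset ℝ).map fun a => X - C a).prod := by
  have hs : (C r + C s : ℝ[X]) = -(C lam * (1 + C η)) := by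
    rw [← C_add, hsum]; simp
  have hp : (C r * C s : ℝ[X]) = C lam ^ 2 * C η - 1 := by
    rw [← C_mul, hprod]; simp
  have hdet : (Amat lam η).charpoly =
      (X ^ 2 + C lam * (1 + C η) * X + (C lam ^ 2 * C η - 1)) ^ 2 := by
    simp [Matrix.charpoly, Matrix.charmatrix, Amat, Matrix.det_succ_row_zero, Fin.sum_univ_succ,
      Fin.succAbove]
    ring
  rw [hdet, ← hp, ← neg_eq_iff_eq_neg.mpr hs]
  simp
  ring

theorem Amat_roots_charpoly {lam η r s : ℝ} (hsum : r + s = -(lam * (1 + η)))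
    (hprod : r * s = lam ^ 2 * η - 1) :
    (Amat lam η).charpoly.roots = {r, r, s, s} := by
  rw [Amat_charpoly hsum hprod, Polynomial.roots_multiset_prod_X_sub_C]

theorem exists_sum_prod_eq (lam η : ℝ) :
    ∃ r s : ℝ, r ≤ s ∧ r + s = -(lam * (1 + η)) ∧ r * s = lam ^ 2 * η - 1 := by
  have hD : 0 ≤ (lam * (1 - η)) ^ 2 + 4 := by positivity
  have h := Real.sq_sqrt hD
  have h0 := Real.sqrt_nonneg ((lam * (1 - η)) ^ 2 + 4)
  refine ⟨(-(lam * (1 + η)) - √((lam * (1 - η)) ^ 2 + 4)) / 2,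
    (-(lam * (1 + η)) + √((lam * (1 - η)) ^ 2 + 4)) / 2, by linarith, by ring, ?_⟩
  linear_combination -h / 4

/-- Counting eigenvalues with multiplicity amounts to counting roots of the characteristic
polynomial. -/
theorem Matrix.IsHermitian.card_eigenvalues_subtype {n : Type*} [Fintype n] [DecidableEq n]
    {S : Matrix n n ℝ} (hS : S.IsHermitian) (p : ℝ → Prop) [DecidablePred p] :
    Nat.card {i // p (hS.eigenvalues i)} = S.charpoly.roots.countP p := by
  rw [hS.roots_charpoly_eq_eigenvalues, Multiset.countP_map, Nat.card_eq_fintype_card,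
    Fintype.card_subtype]
  rfl

/-- For `λ, η > 0`: if `λ²η > 1` then all four eigenvalues of `A(λ,η)` are negative
(`m⁻ = 4`); if `0 < λ²η < 1` then `A(λ,η)` has exactly two negative and two positive
eigenvalues (`m⁻ = 2`, `m⁺ = 2`). -/
theorem stmt12 (lam η : ℝ) (hlam : 0 < lam) (hη : 0 < η)
    (hT : (Amat lam η).IsHermitian) :
    (1 < lam ^ 2 * η → morseIndex hT = 4) ∧
    (lam ^ 2 * η < 1 → morseIndex hT = 2 ∧ posIndex hT = 2) := by
  obtain ⟨r, s, hrs, hsum, hprod⟩ := exists_sum_prod_eq lam η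
  have hneg : 0 < lam * (1 + η) := by positivity
  have hr : r < 0 := by linarith
  rw [morseIndex, posIndex, hT.card_eigenvalues_subtype (· < 0),
    hT.card_eigenvalues_subtype (0 < ·), Amat_roots_charpoly hsum hprod]
  simp only [Multiset.insert_eq_cons, Multiset.countP_cons, ← Multiset.cons_zero,
    Multiset.countP_zero]
  refine ⟨fun h => ?_, fun h => ?_⟩
  · have hs : s < 0 := by nlinarith
    simp [hr, hs]
  · have hs : 0 < s := by nlinarith
    simp [hr, hs, hr.not_gt, hs.not_gt]
end

section
/- The point Q = (d₀, 0, 0, 0, −ω·d₀, 0) ∈ ℝ⁶ is a critical point of H, i.e., the Fréchet derivative of H at Q is zero. -/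
/-- The Hamiltonian of the satellite problem in the rotating frame:
`H(q₁,q₂,q₃,p₁,p₂,p₃) = ½(p₁²+p₂²+p₃²) + ω(q₁p₂ − q₂p₁) − 1/d − c/d³ + 3c·q₃²/d⁵`,
where `d = √(q₁²+q₂²+q₃²)`. -/
noncomputable def satH (ω c : ℝ) (z : Fin 6 → ℝ) : ℝ :=
  (1 / 2) * (z 3 ^ 2 + z 4 ^ 2 + z 5 ^ 2) + ω * (z 0 * z 4 - z 1 * z 3)
    - 1 / Real.sqrt (z 0 ^ 2 + z 1 ^ 2 + z 2 ^ 2)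
    - c / Real.sqrt (z 0 ^ 2 + z 1 ^ 2 + z 2 ^ 2) ^ 3
    + 3 * c * z 2 ^ 2 / Real.sqrt (z 0 ^ 2 + z 1 ^ 2 + z 2 ^ 2) ^ 5

/-- The radial part `-1/√r - c/√r³` of the potential, as a function of `r = d²`, and its
derivative at `r = d²`. -/
theorem hasDerivAt_radial_potential (c : ℝ) {d : ℝ} (hd : 0 < d) :
    HasDerivAt (fun r : ℝ => -(1 / √r) - c / √r ^ 3)
      ((d ^ 2 + 3 * c) / (2 * d ^ 5)) (d ^ 2) := by
  have hs : √(d ^ 2) = d := Real.sqrt_sq hd.le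
  have h := Real.hasDerivAt_sqrt (pow_pos hd 2).ne'
  have h1 := (hasDerivAt_const (d ^ 2) (1 : ℝ)).fun_div h (by rw [hs]; exact hd.ne')
  have h3 := (hasDerivAt_const (d ^ 2) c).fun_div (h.fun_pow 3) (by rw [hs]; positivity)
  refine (h1.fun_neg.fun_sub h3).congr_deriv ?_
  rw [hs]
  field_simp
  ring

/-- The function `1/√r⁵` is differentiable away from `0`. -/
theorem differentiableAt_inv_sqrt_pow_five {r : ℝ} (hr : 0 < r) :
    DifferentiableAt ℝ (fun r : ℝ => (√r ^ 5)⁻¹) r :=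
  ((Real.hasDerivAt_sqrt hr.ne').differentiableAt.fun_pow 5).fun_inv
    (pow_pos (Real.sqrt_pos.2 hr) 5).ne'

/-- The point `Q = (d₀, 0, 0, 0, −ω·d₀, 0)` is a critical point of `H`: the Fréchet derivative
of `H` at `Q` vanishes. -/
theorem stmt14 (ω c d₀ : ℝ) (hω : 0 < ω) (hc : 0 < c)
    (hd₀ : 0 < d₀) (hroot : ω ^ 2 * d₀ ^ 5 = d₀ ^ 2 + 3 * c) :
    HasFDerivAt (satH ω c) (0 : (Fin 6 → ℝ) →L[ℝ] ℝ) ![d₀, 0, 0, 0, -(ω * d₀), 0] := by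
  set Q : Fin 6 → ℝ := ![d₀, 0, 0, 0, -(ω * d₀), 0] with hQ
  have hz (i : Fin 6) : HasFDerivAt (fun z : Fin 6 → ℝ => z i)
      (ContinuousLinearMap.proj (R := ℝ) (φ := fun _ : Fin 6 => ℝ) i) Q := hasFDerivAt_apply i Q
  have hρ := (((hz 0).pow 2).fun_add ((hz 1).pow 2)).fun_add ((hz 2).pow 2)
  have hρQ : Q 0 ^ 2 + Q 1 ^ 2 + Q 2 ^ 2 = d₀ ^ 2 := by simp [hQ]
  have hφ := (hρQ.symm ▸ hasDerivAt_radial_potential c hd₀ :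
    HasDerivAt _ _ (Q 0 ^ 2 + Q 1 ^ 2 + Q 2 ^ 2)).comp_hasFDerivAt Q hρ
  have hψ := (differentiableAt_inv_sqrt_pow_five
    (hρQ.symm ▸ pow_pos hd₀ 2 : 0 < Q 0 ^ 2 + Q 1 ^ 2 + Q 2 ^ 2)).hasDerivAt.comp_hasFDerivAt Q hρ
  have hkin := ((((hz 3).pow 2).fun_add ((hz 4).pow 2)).fun_add
    ((hz 5).pow 2)).const_mul (1 / 2)
  have hrot := (((hz 0).fun_mul (hz 4)).fun_sub ((hz 1).fun_mul (hz 3))).const_mul ω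
  have hzz := ((hz 2).pow 2).const_mul (3 * c)
  have key := ((hkin.fun_add hrot).fun_add hφ).fun_add (hzz.fun_mul hψ)
  refine (key.congr_fderiv ?_).congr_of_eventuallyEq (.of_forall fun z => ?_)
  · ext v
    have hcancel : (d₀ ^ 2 + 3 * c) / (2 * d₀ ^ 5) = ω ^ 2 / 2 := by
      rw [← hroot]; field_simp
    rw [hρQ, hcancel]
    simp [hQ]
    ring
  · simp only [satH, Function.comp_apply]
    ring
end

section
/- Every critical point (q₁,q₂,q₃,p₁,p₂,p₃) of H with q₁² + q₂² > 0 satisfies q₃ = 0, p₃ = 0, p₁ = ω·q₂, p₂ = −ω·q₁, and q₁² + q₂² = d₀². In particular, the critical points of H with q₁² + q₂² > 0 form exactly the SO(2)-orbit of the point (d₀, 0, 0, 0, −ω·d₀, 0). -/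
/-- The gradient of `satH` away from the origin of the position space. -/
lemma hasFDerivAt_satH (ω c : ℝ) {z : Fin 6 → ℝ} {d : ℝ} (hd : 0 < d)
    (hdz : d ^ 2 = z 0 ^ 2 + z 1 ^ 2 + z 2 ^ 2) :
    HasFDerivAt (satH ω c)
      ((ω * z 4 + z 0 * (d ^ 4 + 3 * c * d ^ 2 - 15 * c * z 2 ^ 2) / d ^ 7) •
          ContinuousLinearMap.proj (R := ℝ) (φ := fun _ : Fin 6 => ℝ) 0
        + (-(ω * z 3) + z 1 * (d ^ 4 + 3 * c * d ^ 2 - 15 * c * z 2 ^ 2) / d ^ 7) •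
          ContinuousLinearMap.proj (R := ℝ) (φ := fun _ : Fin 6 => ℝ) 1
        + (z 2 * (d ^ 4 + 9 * c * d ^ 2 - 15 * c * z 2 ^ 2) / d ^ 7) •
          ContinuousLinearMap.proj (R := ℝ) (φ := fun _ : Fin 6 => ℝ) 2
        + (z 3 - ω * z 1) • ContinuousLinearMap.proj (R := ℝ) (φ := fun _ : Fin 6 => ℝ) 3
        + (z 4 + ω * z 0) • ContinuousLinearMap.proj (R := ℝ) (φ := fun _ : Fin 6 => ℝ) 4
        + z 5 • ContinuousLinearMap.proj (R := ℝ) (φ := fun _ : Fin 6 => ℝ) 5) z := by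
  have hp (i : Fin 6) : HasFDerivAt (fun y : Fin 6 → ℝ => y i)
      (ContinuousLinearMap.proj (R := ℝ) (φ := fun _ : Fin 6 => ℝ) i) z := hasFDerivAt_apply i z
  have hsqrt : Real.sqrt (z 0 ^ 2 + z 1 ^ 2 + z 2 ^ 2) = d := by
    rw [← hdz, Real.sqrt_sq hd.le]
  have hr : HasFDerivAt (fun y : Fin 6 → ℝ => Real.sqrt (y 0 ^ 2 + y 1 ^ 2 + y 2 ^ 2)) _ z :=
    ((((hp 0).pow 2).add ((hp 1).pow 2)).add ((hp 2).pow 2)).sqrt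
      (by simpa [← hdz] using hd.ne')
  have hinv (a : ℝ) (n : ℕ) : HasDerivAt (fun x : ℝ => a / x ^ n) _
      (Real.sqrt (z 0 ^ 2 + z 1 ^ 2 + z 2 ^ 2)) :=
    (hasDerivAt_const _ a).div (hasDerivAt_pow n _) (by rw [hsqrt]; positivity)
  have hkin := ((((hp 3).pow 2).add ((hp 4).pow 2)).add ((hp 5).pow 2)).const_mul (1 / 2)
  have hrot := (((hp 0).mul (hp 4)).sub ((hp 1).mul (hp 3))).const_mul ω
  have hoct := (((hp 2).pow 2).const_mul (3 * c)).mul ((hinv 1 5).comp_hasFDerivAt z hr)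
  have h := (((hkin.add hrot).sub ((hinv 1 1).comp_hasFDerivAt z hr)).sub
    ((hinv c 3).comp_hasFDerivAt z hr)).add hoct
  refine (h.congr_fderiv ?_).congr_of_eventuallyEq (.of_forall fun y => ?_)
  · ext v
    simp [hsqrt]
    field_simp
    ring
  · simp [satH, div_eq_mul_inv]

/-- Away from the origin of the position space, a critical point of `satH` is a common zero of
its six partial derivatives. -/
lemma fderiv_satH_eq_zero_iff (ω c : ℝ) {z : Fin 6 → ℝ} {d : ℝ} (hd : 0 < d)
    (hdz : d ^ 2 = z 0 ^ 2 + z 1 ^ 2 + z 2 ^ 2) :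
    fderiv ℝ (satH ω c) z = 0 ↔
      ω * z 4 + z 0 * (d ^ 4 + 3 * c * d ^ 2 - 15 * c * z 2 ^ 2) / d ^ 7 = 0 ∧
      -(ω * z 3) + z 1 * (d ^ 4 + 3 * c * d ^ 2 - 15 * c * z 2 ^ 2) / d ^ 7 = 0 ∧
      z 2 * (d ^ 4 + 9 * c * d ^ 2 - 15 * c * z 2 ^ 2) / d ^ 7 = 0 ∧
      z 3 - ω * z 1 = 0 ∧ z 4 + ω * z 0 = 0 ∧ z 5 = 0 := by
  rw [(hasFDerivAt_satH ω c hd hdz).fderiv]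
  constructor
  · intro h
    have hi (i : Fin 6) := DFunLike.congr_fun h (Pi.single i (1 : ℝ))
    refine ⟨?_, ?_, ?_, ?_, ?_, ?_⟩
    · simpa using hi 0
    · simpa using hi 1
    · simpa using hi 2
    · simpa using hi 3
    · simpa using hi 4
    · simpa using hi 5
  · rintro ⟨h0, h1, h2, h3, h4, h5⟩
    simp only [h0, h1, h2, h3, h4, h5, zero_smul, add_zero]

/-- `ω² d⁵ = d² + 3c` has at most one positive root. -/
lemma radius_unique {ω c x y : ℝ} (hc : 0 < c) (hx : 0 < x) (hy : 0 < y)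
    (hxr : ω ^ 2 * x ^ 5 = x ^ 2 + 3 * c) (hyr : ω ^ 2 * y ^ 5 = y ^ 2 + 3 * c) : x = y := by
  have key : (y - x) * (x ^ 2 * y ^ 2 * (x ^ 2 + x * y + y ^ 2)
      + 3 * c * (x ^ 4 + x ^ 3 * y + x ^ 2 * y ^ 2 + x * y ^ 3 + y ^ 4)) = 0 := by
    linear_combination x ^ 5 * hyr - y ^ 5 * hxr
  rcases mul_eq_zero.mp key with h | h
  · linarith
  · exact absurd h (by positivity)

lemma satH_critical_point {ω c d₀ : ℝ} (hω : 0 < ω) (hc : 0 < c) (hd₀ : 0 < d₀)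
    (hroot : ω ^ 2 * d₀ ^ 5 = d₀ ^ 2 + 3 * c) {z : Fin 6 → ℝ} (hz : 0 < z 0 ^ 2 + z 1 ^ 2)
    (hcrit : fderiv ℝ (satH ω c) z = 0) :
    z 2 = 0 ∧ z 5 = 0 ∧ z 3 = ω * z 1 ∧ z 4 = -(ω * z 0) ∧ z 0 ^ 2 + z 1 ^ 2 = d₀ ^ 2 := by
  have hpos : 0 < z 0 ^ 2 + z 1 ^ 2 + z 2 ^ 2 := by positivity
  obtain ⟨d, hd, hdz⟩ : ∃ d : ℝ, 0 < d ∧ d ^ 2 = z 0 ^ 2 + z 1 ^ 2 + z 2 ^ 2 :=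
    ⟨_, Real.sqrt_pos.mpr hpos, Real.sq_sqrt hpos.le⟩
  obtain ⟨h0, h1, h2, h3, h4, h5⟩ := (fderiv_satH_eq_zero_iff ω c hd hdz).mp hcrit
  have hz3 : z 3 = ω * z 1 := by linarith
  have hz4 : z 4 = -(ω * z 0) := by linarith
  rw [hz4] at h0
  rw [hz3] at h1
  field_simp at h0 h1 h2
  have hK : d ^ 4 + 3 * c * d ^ 2 - 15 * c * z 2 ^ 2 = ω ^ 2 * d ^ 7 := by
    refine mul_left_cancel₀ hz.ne' ?_
    linear_combination z 0 * h0 + z 1 * h1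
  have hz2 : z 2 = 0 := by
    refine (mul_eq_zero.mp (?_ : z 2 * (ω ^ 2 * d ^ 7 + 6 * c * d ^ 2) = 0)).resolve_right
      (by positivity)
    linear_combination h2 - z 2 * hK
  have hdr : ω ^ 2 * d ^ 5 = d ^ 2 + 3 * c := by
    refine mul_left_cancel₀ (pow_ne_zero 2 hd.ne') ?_
    rw [hz2] at hK
    linear_combination -hK
  refine ⟨hz2, h5, hz3, hz4, ?_⟩
  rw [← radius_unique hc hd hd₀ hdr hroot, hdz, hz2]
  ring

/-- Every critical point of `H` with `q₁² + q₂² > 0` satisfies `q₃ = 0`, `p₃ = 0`,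
`p₁ = ω·q₂`, `p₂ = −ω·q₁` and `q₁² + q₂² = d₀²`; the critical points with `q₁² + q₂² > 0`
form exactly the `SO(2)`-orbit of `(d₀, 0, 0, 0, −ω·d₀, 0)`. -/
theorem stmt15 (ω c d₀ : ℝ) (hω : 0 < ω) (hc : 0 < c)
    (hd₀ : 0 < d₀) (hroot : ω ^ 2 * d₀ ^ 5 = d₀ ^ 2 + 3 * c) :
    {z : Fin 6 → ℝ | 0 < z 0 ^ 2 + z 1 ^ 2 ∧ fderiv ℝ (satH ω c) z = 0}
      = {z : Fin 6 → ℝ | ∃ θ : ℝ,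
          z = ![d₀ * Real.cos θ, d₀ * Real.sin θ, 0,
               ω * d₀ * Real.sin θ, -(ω * d₀ * Real.cos θ), 0]} ∧
    ∀ z : Fin 6 → ℝ, 0 < z 0 ^ 2 + z 1 ^ 2 → fderiv ℝ (satH ω c) z = 0 →
      z 2 = 0 ∧ z 5 = 0 ∧ z 3 = ω * z 1 ∧ z 4 = -(ω * z 0) ∧
        z 0 ^ 2 + z 1 ^ 2 = d₀ ^ 2 := by
  refine ⟨Set.ext fun z => ⟨?_, ?_⟩, fun z => satH_critical_point hω hc hd₀ hroot⟩
  · rintro ⟨hz, hcrit⟩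
    obtain ⟨h2, h5, h3, h4, hr⟩ := satH_critical_point hω hc hd₀ hroot hz hcrit
    have hnorm : ‖(⟨z 0, z 1⟩ : ℂ)‖ = d₀ := by
      rw [← sq_eq_sq₀ (norm_nonneg _) hd₀.le, Complex.sq_norm, Complex.normSq_mk, ← hr]
      ring
    have hcos := Complex.norm_mul_cos_arg ⟨z 0, z 1⟩
    have hsin := Complex.norm_mul_sin_arg ⟨z 0, z 1⟩
    rw [hnorm] at hcos hsin
    refine ⟨Complex.arg ⟨z 0, z 1⟩, ?_⟩
    rw [mul_assoc ω, mul_assoc ω, hcos, hsin]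
    ext i
    fin_cases i <;> simp [h2, h3, h4, h5]
  · rintro ⟨θ, rfl⟩
    have hr : (d₀ * Real.cos θ) ^ 2 + (d₀ * Real.sin θ) ^ 2 = d₀ ^ 2 := by
      linear_combination d₀ ^ 2 * Real.sin_sq_add_cos_sq θ
    refine ⟨by simpa [hr] using pow_pos hd₀ 2, ?_⟩
    rw [fderiv_satH_eq_zero_iff ω c hd₀ (by simp [hr])]
    simp
    field_simp
    refine ⟨?_, ?_, by ring, by ring⟩
    · linear_combination -Real.cos θ * hroot
    · linear_combination -Real.sin θ * hroot
end

section
/- Let ω be a real number and let a < 0 < b be real numbers. Consider the 6×6 real symmetric matrix M = [[a, 0, 0, 0, ω, 0],[0, ω², 0, −ω, 0, 0],[0, 0, b, 0, 0, 0],[0, −ω, 0, 1, 0, 0],[ω, 0, 0, 0, 1, 0],[0, 0, 0, 0, 0, 1]]. Then the kernel of M is one-dimensional (spanned by the vector (0, 1, 0, ω, 0, 0)), and the number of positive eigenvalues of M counted with multiplicity is either 2 or 4; in particular it is not equal to 3. -/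
open Matrix

theorem posIndex_eq_countP_roots_charpoly {n : Type*} [Fintype n] [DecidableEq n]
    {S : Matrix n n ℝ} (hS : S.IsHermitian) :
    posIndex hS = S.charpoly.roots.countP (0 < ·) := by
  classical
  rw [hS.roots_charpoly_eq_eigenvalues, Multiset.countP_map, posIndex, Nat.card_eq_fintype_card,
    Fintype.card_subtype]
  simp [Finset.card, Finset.filter]

theorem det_satellite_pattern {R : Type*} [CommRing R] (p q r s t u v w : R) :
    (!![p, 0, 0, 0, q, 0;
        0, r, 0, s, 0, 0;
        0, 0, t, 0, 0, 0;
        0, s, 0, u, 0, 0;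
        q, 0, 0, 0, v, 0;
        0, 0, 0, 0, 0, w] : Matrix (Fin 6) (Fin 6) R).det =
      (p * v - q ^ 2) * (r * u - s ^ 2) * t * w := by
  simp [det_succ_row_zero, Fin.sum_univ_succ, Fin.succAbove]
  ring

open Polynomial in
theorem charpoly_satellite_hessian (ω a b r s : ℝ) (hsum : r + s = a + 1)
    (hprod : r * s = a - ω ^ 2) :
    (!![a, 0, 0, 0, ω, 0;
        0, ω ^ 2, 0, -ω, 0, 0;
        0, 0, b, 0, 0, 0;
        0, -ω, 0, 1, 0, 0;
        ω, 0, 0, 0, 1, 0;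
        0, 0, 0, 0, 0, 1] : Matrix (Fin 6) (Fin 6) ℝ).charpoly =
      (({b, 1, 0, 1 + ω ^ 2, r, s} : Multiset ℝ).map fun c => X - C c).prod := by
  have hsum' : (C r + C s : ℝ[X]) = C a + 1 := by
    rw [← C_add, hsum, C_add, C_1]
  have hprod' : (C r * C s : ℝ[X]) = C a - C ω ^ 2 := by
    rw [← C_mul, hprod, C_sub, C_pow]
  have hfactor : ((X - C r) * (X - C s) : ℝ[X]) = (X - C a) * (X - 1) - C ω ^ 2 := by
    linear_combination -X * hsum' + hprod'
  have hchar : (!![a, 0, 0, 0, ω, 0;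
      0, ω ^ 2, 0, -ω, 0, 0;
      0, 0, b, 0, 0, 0;
      0, -ω, 0, 1, 0, 0;
      ω, 0, 0, 0, 1, 0;
      0, 0, 0, 0, 0, 1] : Matrix (Fin 6) (Fin 6) ℝ).charmatrix =
      !![X - C a, 0, 0, 0, -C ω, 0;
        0, X - C ω ^ 2, 0, C ω, 0, 0;
        0, 0, X - C b, 0, 0, 0;
        0, C ω, 0, X - 1, 0, 0;
        -C ω, 0, 0, 0, X - 1, 0;
        0, 0, 0, 0, 0, X - 1] := by
    ext1 i j
    fin_cases i <;> fin_cases j <;> simp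
  rw [charpoly, hchar, det_satellite_pattern]
  simp only [Multiset.insert_eq_cons, Multiset.map_cons, Multiset.map_singleton,
    Multiset.prod_cons, Multiset.prod_singleton, hfactor, C_add, C_pow, C_0, C_1]
  ring

/-- For the `6 × 6` symmetric matrix `M` (the Hessian of the satellite Hamiltonian at the
critical point), with `a < 0 < b`: the kernel of `M` is one-dimensional, spanned by
`(0, 1, 0, ω, 0, 0)`, and the number of positive eigenvalues of `M` is `2` or `4`;
in particular it is not `3`. -/
theorem stmt16 (ω a b : ℝ) (ha : a < 0) (hb : 0 < b)
    (hM : (!![a, 0, 0, 0, ω, 0;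
              0, ω ^ 2, 0, -ω, 0, 0;
              0, 0, b, 0, 0, 0;
              0, -ω, 0, 1, 0, 0;
              ω, 0, 0, 0, 1, 0;
              0, 0, 0, 0, 0, 1] : Matrix (Fin 6) (Fin 6) ℝ).IsHermitian) :
    (∀ v : Fin 6 → ℝ,
        (!![a, 0, 0, 0, ω, 0;
            0, ω ^ 2, 0, -ω, 0, 0;
            0, 0, b, 0, 0, 0;
            0, -ω, 0, 1, 0, 0;
            ω, 0, 0, 0, 1, 0;
            0, 0, 0, 0, 0, 1] : Matrix (Fin 6) (Fin 6) ℝ).mulVec v = 0 ↔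
          ∃ t : ℝ, v = t • ![0, 1, 0, ω, 0, 0]) ∧
    (posIndex hM = 2 ∨ posIndex hM = 4) ∧ posIndex hM ≠ 3 := by
  have hpos : posIndex hM = 4 := by
    obtain ⟨r, s, hr, hs, hsum, hprod⟩ : ∃ r s : ℝ, 0 < r ∧ s < 0 ∧ r + s = a + 1 ∧
        r * s = a - ω ^ 2 := by
      have hd : 0 ≤ (a + 1) ^ 2 - 4 * (a - ω ^ 2) := by nlinarith [sq_nonneg ω, sq_nonneg (a + 1)]
      have hlt : |a + 1| < √((a + 1) ^ 2 - 4 * (a - ω ^ 2)) := by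
        apply Real.lt_sqrt_of_sq_lt
        rw [sq_abs]
        nlinarith [sq_nonneg ω]
      obtain ⟨h₁, h₂⟩ := abs_lt.mp hlt
      have hsq := Real.sq_sqrt hd
      refine ⟨(a + 1 + √((a + 1) ^ 2 - 4 * (a - ω ^ 2))) / 2,
        (a + 1 - √((a + 1) ^ 2 - 4 * (a - ω ^ 2))) / 2, ?_, ?_, ?_, ?_⟩
      · linarith
      · linarith
      · ring
      · linear_combination -hsq / 4
    have hω : 0 < 1 + ω ^ 2 := by positivity
    rw [posIndex_eq_countP_roots_charpoly, charpoly_satellite_hessian ω a b r s hsum hprod,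
      Polynomial.roots_multiset_prod_X_sub_C]
    simp [← Multiset.cons_zero, hb, hω, hr, hs.le]
  refine ⟨fun v => ⟨fun h => ?_, ?_⟩, Or.inr hpos, by omega⟩
  · have h0 := congrFun h 0
    have h2 := congrFun h 2
    have h3 := congrFun h 3
    have h4 := congrFun h 4
    have h5 := congrFun h 5
    simp [mulVec, dotProduct, Fin.sum_univ_succ] at h0 h2 h3 h4 h5
    have hv0 : v 0 = 0 := by
      have hne : a - ω ^ 2 ≠ 0 := by nlinarith [sq_nonneg ω]
      refine (mul_eq_zero.mp ?_).resolve_left hne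
      linear_combination h0 - ω * h4
    have hv2 : v 2 = 0 := h2.resolve_left hb.ne'
    have hv3 : v 3 = v 1 * ω := by linear_combination h3
    have hv4 : v 4 = 0 := by simpa [hv0] using h4
    refine ⟨v 1, ?_⟩
    ext i
    fin_cases i <;> simp [hv0, hv2, hv3, hv4, h5]
  · rintro ⟨t, rfl⟩
    ext i
    fin_cases i <;> simp [mulVec, dotProduct, Fin.sum_univ_succ] <;> ring
end
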